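/- Let H be a complex Hilbert space and let a be an element of the closed unit ball of C_1(H) (trace norm at most 1) which is not an extreme point of that ball, written as a = ∑_{n≥1} μ_n(a) η_n ⊗ ξ_n with (ξ_n), (η_n) orthonormal systems in H and (μ_n(a)) the decreasing sequence of singular values of a. Set λ₀ = (1 − ‖a‖₁ + 2‖a‖_∞)/2, e₁ = η₁ ⊗ ξ₁, and y = ((‖a‖₁ − 1)/(1 + ‖a‖₁ − 2‖a‖_∞)) e₁ + ∑_{n≥2} (2 μ_n(a)/(1 + ‖a‖₁ − 2‖a‖_∞)) η_n ⊗ ξ_n. Then ‖y‖₁ = 1 and a = λ₀ e₁ + (1 − λ₀) y. -/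

import Mathlib

/-! Setting: `H` is a complex Hilbert space, and we consider the space `C₁(H)` of trace class
operators on `H` (more generally the Schatten classes `C_p(H)`), regarded as those bounded
operators `a : H →L[ℂ] H` that are compact and whose sequence of singular values is
`p`-summable. The singular values `μₙ(a)` of a compact operator `a` (the eigenvalues of
`|a| = (a^* a)^(1/2)` arranged in decreasing order and repeated according to multiplicity)
are realized here via the approximation numbers, which coincide with them. -/

/-- `sValue a n` is the `n`-th approximation number (`0`-indexed) of `a`, namely the distance
from `a` to the operators of rank at most `n`.  For a compact operator on a Hilbert space this
coincides with the `(n+1)`-th singular value `μ_{n+1}(a)`, i.e. the `(n+1)`-th eigenvalue of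
`|a| = (a^* a)^(1/2)` arranged in decreasing order and repeated according to multiplicity.  In
particular `sValue a 0 = μ₁(a) = ‖a‖`. -/
noncomputable def sValue {H : Type*} [NormedAddCommGroup H] [InnerProductSpace ℂ H]
    (a : H →L[ℂ] H) (n : ℕ) : ℝ :=
  sInf {r : ℝ | ∃ F : H →L[ℂ] H, LinearMap.rank (F : H →ₗ[ℂ] H) ≤ (n : Cardinal) ∧ r = ‖a - F‖}

/-- Membership in the Schatten class `C_p(H)`: `a` is a compact operator with
`‖a‖_p^p = ∑ₙ μₙ(a)^p < ∞`. -/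
def MemSchatten {H : Type*} [NormedAddCommGroup H] [InnerProductSpace ℂ H]
    (p : ℝ) (a : H →L[ℂ] H) : Prop :=
  IsCompactOperator a ∧ Summable (fun n => sValue a n ^ p)

/-- Membership in the trace class `C₁(H)`: `a` is a compact operator with
`‖a‖₁ = tr |a| = ∑ₙ μₙ(a) < ∞`. -/
def MemTraceClass {H : Type*} [NormedAddCommGroup H] [InnerProductSpace ℂ H]
    (a : H →L[ℂ] H) : Prop :=
  IsCompactOperator a ∧ Summable (fun n => sValue a n)

/-- The trace norm `‖a‖₁ = tr |a| = ∑ₙ μₙ(a)`. -/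
noncomputable def traceNorm {H : Type*} [NormedAddCommGroup H] [InnerProductSpace ℂ H]
    (a : H →L[ℂ] H) : ℝ :=
  ∑' n, sValue a n

/-- The closed unit ball of `C₁(H)` with respect to the trace norm `‖·‖₁`. -/
def traceBall (H : Type*) [NormedAddCommGroup H] [InnerProductSpace ℂ H] :
    Set (H →L[ℂ] H) :=
  {x | MemTraceClass x ∧ traceNorm x ≤ 1}

/-- The λ-function of Aron and Lohman on the closed unit ball of `C₁(H)`:
`λ(a) = sup { t : (e, y, t) ∈ ∂ₑ(B) × B × [0,1] is a triplet amenable to a }`,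
where a triplet `(e, y, t)` is amenable to `a` when `a = t • e + (1 - t) • y`. -/
noncomputable def lambdaFn {H : Type*} [NormedAddCommGroup H] [InnerProductSpace ℂ H]
    (a : H →L[ℂ] H) : ℝ :=
  sSup {t : ℝ | t ∈ Set.Icc (0 : ℝ) 1 ∧
    ∃ e ∈ Set.extremePoints ℝ (traceBall H), ∃ y ∈ traceBall H, a = t • e + (1 - t) • y}

/-- A minimal (i.e. rank-one) partial isometry: `e e^* e = e` and `e` has rank one. -/
def IsMinimalPartialIsometry {H : Type*} [NormedAddCommGroup H] [InnerProductSpace ℂ H]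
    [CompleteSpace H] (e : H →L[ℂ] H) : Prop :=
  e ∘L (ContinuousLinearMap.adjoint e) ∘L e = e ∧ LinearMap.rank (e : H →ₗ[ℂ] H) = 1

/-- The rank one operator `η ⊗ ξ : ζ ↦ ⟨ζ, ξ⟩ η` (Mathlib's inner product being conjugate
linear in the first variable, this is `ζ ↦ ⟪ξ, ζ⟫ • η`). -/
noncomputable def rankOneOp {H : Type*} [NormedAddCommGroup H] [InnerProductSpace ℂ H]
    (η ξ : H) : H →L[ℂ] H :=
  (innerSL ℂ ξ).smulRight η

section SingularValues

open scoped InnerProductSpace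

variable {H : Type*} [NormedAddCommGroup H] [InnerProductSpace ℂ H]

lemma rankOneOp_apply (η ξ v : H) : rankOneOp η ξ v = ⟪ξ, v⟫_ℂ • η := rfl

lemma norm_rankOneOp (η ξ : H) : ‖rankOneOp η ξ‖ = ‖ξ‖ * ‖η‖ := by
  rw [rankOneOp, ContinuousLinearMap.norm_smulRight_apply, innerSL_apply_norm]

lemma norm_sq_sum_of_pairwise_inner_eq_zero {ι : Type*} (s : Finset ι) (u : ι → H)
    (hu : Pairwise fun i j => ⟪u i, u j⟫_ℂ = 0) :
    ‖∑ i ∈ s, u i‖ ^ 2 = ∑ i ∈ s, ‖u i‖ ^ 2 := by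
  classical
  induction s using Finset.induction_on with
  | empty => simp
  | insert i s hi ih =>
    have h : ⟪u i, ∑ j ∈ s, u j⟫_ℂ = 0 := by
      rw [inner_sum]
      exact Finset.sum_eq_zero fun j hj => hu fun hij => hi (hij ▸ hj)
    rw [Finset.sum_insert hi, Finset.sum_insert hi, ← ih, sq, sq, sq]
    exact norm_add_sq_eq_norm_sq_add_norm_sq_of_inner_eq_zero _ _ h

lemma sValue_bddBelow (a : H →L[ℂ] H) (n : ℕ) :
    BddBelow {r : ℝ | ∃ F : H →L[ℂ] H,
      LinearMap.rank (F : H →ₗ[ℂ] H) ≤ (n : Cardinal) ∧ r = ‖a - F‖} :=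
  ⟨0, by rintro r ⟨F, -, rfl⟩; exact norm_nonneg _⟩

lemma sValue_nonempty (a : H →L[ℂ] H) (n : ℕ) :
    {r : ℝ | ∃ F : H →L[ℂ] H,
      LinearMap.rank (F : H →ₗ[ℂ] H) ≤ (n : Cardinal) ∧ r = ‖a - F‖}.Nonempty :=
  ⟨‖a - 0‖, 0, by simp, rfl⟩

lemma sValue_le {a F : H →L[ℂ] H} {n : ℕ} (hF : LinearMap.rank (F : H →ₗ[ℂ] H) ≤ n) :
    sValue a n ≤ ‖a - F‖ :=
  csInf_le (sValue_bddBelow a n) ⟨F, hF, rfl⟩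

lemma sValue_nonneg (a : H →L[ℂ] H) (n : ℕ) : 0 ≤ sValue a n :=
  Real.sInf_nonneg <| by rintro r ⟨F, -, rfl⟩; exact norm_nonneg _

lemma sValue_antitone (a : H →L[ℂ] H) : Antitone (sValue a) := fun _ _ hmn =>
  csInf_le_csInf (sValue_bddBelow a _) (sValue_nonempty a _) <| by
    rintro r ⟨F, hF, rfl⟩
    exact ⟨F, hF.trans (by exact_mod_cast hmn), rfl⟩

lemma sValue_zero (a : H →L[ℂ] H) : sValue a 0 = ‖a‖ := by
  refine le_antisymm (by simpa using sValue_le (a := a) (F := 0) (n := 0) (by simp)) ?_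
  refine le_csInf (sValue_nonempty a 0) ?_
  rintro r ⟨F, hF, rfl⟩
  have h : F = 0 := by
    have h' : LinearMap.range (F : H →ₗ[ℂ] H) = ⊥ :=
      Submodule.rank_eq_zero.mp (le_antisymm (by simpa using hF) zero_le)
    ext v
    simpa using congrArg (fun f : H →ₗ[ℂ] H => f v) (LinearMap.range_eq_bot.mp h')
  simp [h]

/-- Lower bound for the singular values, by a dimension count: an operator of rank at most `n`
has a kernel meeting every subspace of dimension `n + 1`. -/
lemma le_sValue {a : H →L[ℂ] H} {n : ℕ} {c : ℝ} (hc : 0 ≤ c) {e : Fin (n + 1) → H}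
    (he : Orthonormal ℂ e) (hort : Pairwise fun i j => ⟪a (e i), a (e j)⟫_ℂ = 0)
    (hnorm : ∀ i, c ≤ ‖a (e i)‖) : c ≤ sValue a n := by
  refine le_csInf (sValue_nonempty a n) ?_
  rintro r ⟨F, hF, rfl⟩
  have hker : ∃ w : Fin (n + 1) → ℂ, w ≠ 0 ∧ F (∑ i, w i • e i) = 0 := by
    by_contra! hcon
    let L := (F : H →ₗ[ℂ] H) ∘ₗ Fintype.linearCombination ℂ e
    have hinj : Function.Injective L := by
      rw [← LinearMap.ker_eq_bot, LinearMap.ker_eq_bot']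
      intro w hw
      by_contra hne
      exact hcon w hne (by simpa [L, Fintype.linearCombination_apply] using hw)
    have h1 : LinearMap.rank L ≤ n := (LinearMap.rank_comp_le_left _ _).trans hF
    have h2 : Module.finrank ℂ (LinearMap.range L) ≤ n := Module.finrank_le_of_rank_le h1
    rw [LinearMap.finrank_range_of_inj hinj] at h2
    simp at h2
  obtain ⟨w, hw, hFw⟩ := hker
  set v := ∑ i, w i • e i with hv
  have hv_sq : ‖v‖ ^ 2 = ∑ i, ‖w i‖ ^ 2 := by
    rw [hv, norm_sq_sum_of_pairwise_inner_eq_zero]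
    · simp [norm_smul, he.1]
    · intro i j hij
      simp [he.2 hij]
  have hav_sq : ‖a v‖ ^ 2 = ∑ i, ‖w i‖ ^ 2 * ‖a (e i)‖ ^ 2 := by
    rw [hv, map_sum, norm_sq_sum_of_pairwise_inner_eq_zero]
    · simp [norm_smul, mul_pow]
    · intro i j hij
      simp [hort hij]
  have hvpos : 0 < ‖v‖ := by
    obtain ⟨i, hi⟩ := Function.ne_iff.mp hw
    have : 0 < ‖v‖ ^ 2 := by
      rw [hv_sq]
      exact Finset.sum_pos' (fun _ _ => by positivity)
        ⟨i, Finset.mem_univ i, pow_pos (norm_pos_iff.mpr hi) 2⟩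
    exact (sq_pos_iff.mp this).lt_of_le' (norm_nonneg v)
  have hle : c * ‖v‖ ≤ ‖a v‖ := by
    refine le_of_sq_le_sq ?_ (norm_nonneg _)
    rw [mul_pow, hv_sq, hav_sq, Finset.mul_sum]
    refine Finset.sum_le_sum fun i _ => ?_
    rw [mul_comm]
    gcongr
    exact hnorm i
  have hop : ‖a v‖ ≤ ‖a - F‖ * ‖v‖ := by
    simpa [hFw] using (a - F).le_opNorm v
  exact le_of_mul_le_mul_right (hle.trans hop) hvpos

variable {ξ η : ℕ → H} {c : ℕ → ℝ}

lemma summable_smul_rankOneOp [CompleteSpace H] (hξ : Orthonormal ℂ ξ) (hη : Orthonormal ℂ η)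
    (hc : Summable c) : Summable fun n => c n • rankOneOp (η n) (ξ n) := by
  refine Summable.of_norm ?_
  simpa [norm_smul, norm_rankOneOp, hξ.1, hη.1] using hc.abs

lemma norm_sum_smul_rankOneOp_le (hξ : Orthonormal ℂ ξ) (hη : Orthonormal ℂ η) {M : ℝ}
    (hM : 0 ≤ M) (s : Finset ℕ) (hc : ∀ i ∈ s, |c i| ≤ M) :
    ‖∑ i ∈ s, c i • rankOneOp (η i) (ξ i)‖ ≤ M := by
  refine ContinuousLinearMap.opNorm_le_bound _ hM fun v => ?_
  refine le_of_sq_le_sq ?_ (by positivity)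
  simp only [sum_apply, smul_apply, rankOneOp_apply]
  rw [norm_sq_sum_of_pairwise_inner_eq_zero]
  · calc ∑ i ∈ s, ‖c i • ⟪ξ i, v⟫_ℂ • η i‖ ^ 2
        = ∑ i ∈ s, |c i| ^ 2 * ‖⟪ξ i, v⟫_ℂ‖ ^ 2 := by simp [norm_smul, hη.1, mul_pow]
      _ ≤ ∑ i ∈ s, M ^ 2 * ‖⟪ξ i, v⟫_ℂ‖ ^ 2 := by
          refine Finset.sum_le_sum fun i hi => ?_
          gcongr
          exact hc i hi
      _ ≤ (M * ‖v‖) ^ 2 := by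
          rw [← Finset.mul_sum, mul_pow]
          gcongr
          exact hξ.sum_inner_products_le v
  · intro i j hij
    simp only [← Complex.coe_smul]
    simp [hη.2 hij]

lemma tsum_smul_rankOneOp_apply [CompleteSpace H] (hξ : Orthonormal ℂ ξ) (hη : Orthonormal ℂ η)
    (hc : Summable c) (m : ℕ) :
    (∑' n, c n • rankOneOp (η n) (ξ n)) (ξ m) = c m • η m := by
  have h := (summable_smul_rankOneOp hξ hη hc).hasSum.mapL
    (ContinuousLinearMap.apply ℂ H (ξ m))
  have hm : (c m • rankOneOp (η m) (ξ m)) (ξ m) = c m • η m := by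
    simp [rankOneOp_apply, inner_self_eq_norm_sq_to_K, hξ.1]
  rw [← hm]
  refine h.unique (hasSum_single m fun n hn => ?_)
  simp [rankOneOp_apply, hξ.2 hn]

lemma sValue_tsum_smul_rankOneOp [CompleteSpace H] (hξ : Orthonormal ℂ ξ)
    (hη : Orthonormal ℂ η) (hc : Summable c) (hanti : Antitone fun n => |c n|) (n : ℕ) :
    sValue (∑' n, c n • rankOneOp (η n) (ξ n)) n = |c n| := by
  classical
  refine le_antisymm ?_ ?_
  · have hsum := summable_smul_rankOneOp hξ hη hc
    have hrank : LinearMap.rank ((∑ i ∈ Finset.range n, c i • rankOneOp (η i) (ξ i) :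
        H →L[ℂ] H) : H →ₗ[ℂ] H) ≤ n := by
      have hle : LinearMap.range ((∑ i ∈ Finset.range n, c i • rankOneOp (η i) (ξ i) :
          H →L[ℂ] H) : H →ₗ[ℂ] H) ≤ Submodule.span ℂ (((Finset.range n).image η : Finset H) :
            Set H) := by
        rintro _ ⟨v, rfl⟩
        simp only [ContinuousLinearMap.coe_coe, sum_apply,
          smul_apply, rankOneOp_apply, ← Complex.coe_smul]
        refine Submodule.sum_mem _ fun i hi => Submodule.smul_mem _ _ (Submodule.smul_mem _ _ ?_)
        exact Submodule.subset_span (by exact_mod_cast Finset.mem_image_of_mem η hi)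
      refine (Submodule.rank_mono hle).trans ((rank_span_finset_le _).trans ?_)
      exact_mod_cast Finset.card_image_le.trans (Finset.card_range n).le
    refine (sValue_le hrank).trans ?_
    rw [← hsum.sum_add_tsum_nat_add n, add_sub_cancel_left]
    refine le_of_tendsto (((summable_nat_add_iff n).mpr hsum).hasSum.norm)
      (Filter.Eventually.of_forall fun s => ?_)
    exact norm_sum_smul_rankOneOp_le (c := fun i => c (i + n)) (ξ := fun i => ξ (i + n))
      (η := fun i => η (i + n)) (hξ.comp _ (add_left_injective n))
      (hη.comp _ (add_left_injective n)) (abs_nonneg _) s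
      fun i _ => hanti (Nat.le_add_left n i)
  · refine le_sValue (e := fun i : Fin (n + 1) => ξ i) (abs_nonneg _)
      (hξ.comp _ Fin.val_injective) (fun i j hij => ?_) fun i => ?_
    · have hij' : (i : ℕ) ≠ j := fun h => hij (Fin.ext h)
      beta_reduce
      rw [tsum_smul_rankOneOp_apply hξ hη hc, tsum_smul_rankOneOp_apply hξ hη hc,
        ← Complex.coe_smul, ← Complex.coe_smul]
      simp [hη.2 hij']
    · rw [tsum_smul_rankOneOp_apply hξ hη hc, norm_smul, hη.1, mul_one, Real.norm_eq_abs]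
      exact hanti (Nat.lt_succ_iff.mp i.2)

/-- The trace norm of an orthonormal expansion whose coefficients can be listed in decreasing
order of modulus along `σ`. -/
lemma traceNorm_tsum_smul_rankOneOp [CompleteSpace H] (hξ : Orthonormal ℂ ξ)
    (hη : Orthonormal ℂ η) (hc : Summable c) {σ : ℕ → ℕ} (hσ : Function.Injective σ)
    (hrange : Function.support c ⊆ Set.range σ) (hanti : Antitone fun n => |c (σ n)|) :
    traceNorm (∑' n, c n • rankOneOp (η n) (ξ n)) = ∑' n, |c n| := by
  have hsupp : Function.support (fun n => c n • rankOneOp (η n) (ξ n)) ⊆ Set.range σ :=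
    fun n hn => hrange fun h => hn (by simp [h])
  have habs : Function.support (fun n => |c n|) ⊆ Set.range σ :=
    fun n hn => hrange fun h => hn (by simp [h])
  rw [← hσ.tsum_eq hsupp, ← hσ.tsum_eq habs]
  exact tsum_congr fun n => sValue_tsum_smul_rankOneOp (c := c ∘ σ) (hξ.comp σ hσ)
    (hη.comp σ hσ) (hc.comp_injective hσ) hanti n

/-- A summable sequence whose tail is already decreasing in modulus can be rearranged to be
decreasing in modulus, by inserting its first term at the right place. -/
lemma exists_rearrangement_antitone_abs (hc : Summable c)
    (hanti : Antitone fun n => |c (n + 1)|) :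
    ∃ σ : ℕ → ℕ, Function.Injective σ ∧ Function.support c ⊆ Set.range σ ∧
      Antitone fun n => |c (σ n)| := by
  classical
  by_cases h0 : c 0 = 0
  · refine ⟨Nat.succ, Nat.succ_injective, fun n hn => ?_, hanti⟩
    cases n with
    | zero => exact absurd h0 hn
    | succ n => exact ⟨n, rfl⟩
  have hex : ∃ k, |c (k + 1)| < |c 0| := by
    have ht : Filter.Tendsto (fun k => |c (k + 1)|) Filter.atTop (nhds 0) := by
      simpa using ((Filter.tendsto_add_atTop_iff_nat 1).mpr hc.tendsto_atTop_zero).abs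
    exact (ht.eventually_lt_const (abs_pos.mpr h0)).exists
  obtain ⟨k, hk, hmin⟩ : ∃ k, |c (k + 1)| < |c 0| ∧ ∀ m < k, |c 0| ≤ |c (m + 1)| :=
    ⟨Nat.find hex, Nat.find_spec hex, fun m hm => not_lt.mp (Nat.find_min hex hm)⟩
  refine ⟨fun n => if n < k then n + 1 else if n = k then 0 else n, ?_, ?_, ?_⟩
  · intro m n hmn
    simp only at hmn
    split_ifs at hmn <;> omega
  · intro n _
    rcases Nat.eq_zero_or_pos n with rfl | hn
    · exact ⟨k, by simp⟩
    rcases le_or_gt n k with hnk | hnk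
    · refine ⟨n - 1, ?_⟩
      simp only
      split_ifs <;> omega
    · refine ⟨n, ?_⟩
      simp only
      split_ifs <;> omega
  · refine antitone_nat_of_succ_le fun n => ?_
    rcases lt_trichotomy n k with h | rfl | h
    · rcases Nat.lt_or_ge (n + 1) k with h' | h'
      · simpa [h, h'] using hanti (Nat.le_succ n)
      · obtain rfl : n + 1 = k := le_antisymm h h'
        simpa using hmin n h
    · simpa using hk.le
    · obtain ⟨m, rfl⟩ : ∃ m, n = m + 1 := ⟨n - 1, by omega⟩
      have h1 : ¬ m + 1 < k := by omega
      have h2 : m + 1 ≠ k := by omega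
      have h3 : ¬ m + 1 + 1 < k := by omega
      have h4 : m + 1 + 1 ≠ k := by omega
      simpa only [if_neg h1, if_neg h2, if_neg h3, if_neg h4] using hanti (Nat.le_succ m)

lemma eq_of_one_le_re_inner {u v : H} (hu : ‖u‖ ≤ 1) (hv : ‖v‖ ≤ 1)
    (h : 1 ≤ (⟪u, v⟫_ℂ).re) : u = v := by
  have hsub : ‖u - v‖ ^ 2 = ‖u‖ ^ 2 - 2 * (⟪u, v⟫_ℂ).re + ‖v‖ ^ 2 := norm_sub_sq (𝕜 := ℂ) u v
  have : ‖u - v‖ ^ 2 ≤ 0 := by nlinarith [norm_nonneg u, norm_nonneg v]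
  exact sub_eq_zero.mp (norm_eq_zero.mp (pow_eq_zero_iff two_ne_zero |>.mp
    (le_antisymm this (sq_nonneg _))))

lemma norm_le_one_of_mem_traceBall {x : H →L[ℂ] H} (hx : x ∈ traceBall H) : ‖x‖ ≤ 1 := by
  rw [← sValue_zero]
  exact (hx.1.2.le_tsum 0 fun _ _ => sValue_nonneg x _).trans hx.2

lemma eq_rankOneOp_of_mem_traceBall [CompleteSpace H] {u v : H} (hu : ‖u‖ = 1) (hv : ‖v‖ = 1)
    {x : H →L[ℂ] H} (hx : x ∈ traceBall H) (h : 1 ≤ (⟪v, x u⟫_ℂ).re) : x = rankOneOp v u := by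
  have hx1 := norm_le_one_of_mem_traceBall hx
  have hxu : x u = v := by
    refine (eq_of_one_le_re_inner hv.le ?_ h).symm
    simpa [hu] using x.le_of_opNorm_le hx1 u
  have hxv : ContinuousLinearMap.adjoint x v = u := by
    refine eq_of_one_le_re_inner ?_ hu.le (by rwa [ContinuousLinearMap.adjoint_inner_left])
    have := (ContinuousLinearMap.adjoint x).le_opNorm v
    rw [LinearIsometryEquiv.norm_map, hv, mul_one] at this
    exact this.trans hx1
  have hinner (ζ : H) : ⟪v, x ζ⟫_ℂ = ⟪u, ζ⟫_ℂ := by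
    rw [← ContinuousLinearMap.adjoint_inner_left, hxv]
  have hs1 : sValue x 1 ≤ 0 := by
    have h01 := (hx.1.2.sum_le_tsum {0, 1} fun _ _ => sValue_nonneg x _).trans hx.2
    have h0 : 1 ≤ sValue x 0 := by
      rw [sValue_zero]
      simpa [hxu, hu, hv] using x.le_opNorm u
    rw [Finset.sum_pair zero_ne_one] at h01
    linarith
  have hperp (ζ : H) (hζ : ⟪u, ζ⟫_ℂ = 0) : x ζ = 0 := by
    by_cases hζ0 : ζ = 0
    · simp [hζ0]
    have hpos : 0 < ‖ζ‖ := norm_pos_iff.mpr hζ0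
    let w : H := ((‖ζ‖⁻¹ : ℝ) : ℂ) • ζ
    have hw : ‖w‖ = 1 := by simp [w, norm_smul, hpos.ne']
    have huw : ⟪u, w⟫_ℂ = 0 := by simp [w, hζ]
    have he : Orthonormal ℂ ![u, w] := by
      constructor
      · intro i; fin_cases i <;> simp [hu, hw]
      · intro i j hij
        fin_cases i <;> fin_cases j <;> simp_all [inner_eq_zero_symm]
    have hvw : ⟪v, x w⟫_ℂ = 0 := by rw [hinner, huw]
    have hle : ‖x w‖ ≤ sValue x 1 := by
      refine le_sValue (norm_nonneg _) he (fun i j hij => ?_) fun i => ?_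
      · fin_cases i <;> fin_cases j <;> simp_all [inner_eq_zero_symm]
      · fin_cases i
        · simpa [hxu, hv, hw] using x.le_of_opNorm_le hx1 w
        · simp
    have hxw : x w = 0 := norm_le_zero_iff.mp (hle.trans hs1)
    simpa [w, hζ0] using hxw
  ext ζ
  have h0 := hperp (ζ - ⟪u, ζ⟫_ℂ • u) (by
    simp [inner_self_eq_norm_sq_to_K, hu])
  rw [map_sub, map_smul, hxu, sub_eq_zero] at h0
  rw [h0, rankOneOp_apply]

lemma rankOneOp_mem_extremePoints_traceBall [CompleteSpace H] {u v : H} (hu : ‖u‖ = 1)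
    (hv : ‖v‖ = 1) (hmem : rankOneOp v u ∈ traceBall H) :
    rankOneOp v u ∈ Set.extremePoints ℝ (traceBall H) := by
  refine ⟨hmem, ?_⟩
  rintro x hx z hz ⟨s, t, hs, ht, hst, hxz⟩
  have hbound {x : H →L[ℂ] H} (hx : x ∈ traceBall H) : (⟪v, x u⟫_ℂ).re ≤ 1 := by
    refine (Complex.re_le_norm _).trans ((norm_inner_le_norm _ _).trans ?_)
    simpa [hu, hv] using x.le_of_opNorm_le (norm_le_one_of_mem_traceBall hx) u
  refine eq_rankOneOp_of_mem_traceBall hu hv hx ?_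
  have h1 : s * (⟪v, x u⟫_ℂ).re + t * (⟪v, z u⟫_ℂ).re = 1 := by
    have := congrArg (fun f : H →L[ℂ] H => (⟪v, f u⟫_ℂ).re) hxz
    simpa [rankOneOp_apply, inner_add_right, ← Complex.coe_smul, inner_smul_right,
      inner_self_eq_norm_sq_to_K, hu, hv] using this
  nlinarith [hbound hx, hbound hz]

end SingularValues

/-- Let `H` be a complex Hilbert space and let `a` be an element of the
closed unit ball of `C₁(H)` (trace norm at most `1`) which is not an extreme point of that
ball, written as `a = ∑_{n ≥ 1} μₙ(a) ηₙ ⊗ ξₙ` with `(ξₙ)`, `(ηₙ)` orthonormal systems in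
`H` and `(μₙ(a))` the decreasing sequence of singular values of `a` (here `0`-indexed, so
`μₙ(a) = sValue a (n-1)`). Set `λ₀ = (1 - ‖a‖₁ + 2‖a‖_∞)/2`, `e₁ = η₁ ⊗ ξ₁` and
`y = ((‖a‖₁ - 1)/(1 + ‖a‖₁ - 2‖a‖_∞)) e₁
      + ∑_{n ≥ 2} (2 μₙ(a)/(1 + ‖a‖₁ - 2‖a‖_∞)) ηₙ ⊗ ξₙ`.
Then `‖y‖₁ = 1` and `a = λ₀ e₁ + (1 - λ₀) y`. -/
theorem lambdaFn_witness_decomposition {H : Type*} [NormedAddCommGroup H]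
    [InnerProductSpace ℂ H] [CompleteSpace H] (a : H →L[ℂ] H)
    (ha : a ∈ traceBall H) (hext : a ∉ Set.extremePoints ℝ (traceBall H))
    (ξ η : ℕ → H) (hξ : Orthonormal ℂ ξ) (hη : Orthonormal ℂ η)
    (hdec : a = ∑' n, sValue a n • rankOneOp (η n) (ξ n))
    (lam₀ : ℝ) (hlam₀ : lam₀ = (1 - traceNorm a + 2 * ‖a‖) / 2)
    (e₁ : H →L[ℂ] H) (he₁ : e₁ = rankOneOp (η 0) (ξ 0))
    (y : H →L[ℂ] H)
    (hy : y = ((traceNorm a - 1) / (1 + traceNorm a - 2 * ‖a‖)) • e₁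
        + ∑' n, (2 * sValue a (n + 1) / (1 + traceNorm a - 2 * ‖a‖))
            • rankOneOp (η (n + 1)) (ξ (n + 1))) :
    traceNorm y = 1 ∧ a = lam₀ • e₁ + (1 - lam₀) • y := by
  have hs : Summable (sValue a) := ha.1.2
  set T := traceNorm a with hT
  have hT1 : T ≤ 1 := ha.2
  have hsplit : T = ‖a‖ + ∑' n, sValue a (n + 1) := by
    rw [hT, traceNorm, hs.tsum_eq_zero_add, sValue_zero]
  have hs' : Summable fun n => sValue a (n + 1) := (summable_nat_add_iff 1).mpr hs
  have htail : 0 ≤ ∑' n, sValue a (n + 1) := tsum_nonneg fun n => sValue_nonneg a _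
  have hsum := summable_smul_rankOneOp hξ hη hs
  have ha_split : a = ‖a‖ • e₁
      + ∑' n, sValue a (n + 1) • rankOneOp (η (n + 1)) (ξ (n + 1)) := by
    rw [hsum.tsum_eq_zero_add, sValue_zero, ← he₁] at hdec
    exact hdec
  have hD : 0 < 1 + T - 2 * ‖a‖ := by
    by_contra! hcon
    have hnorm : ‖a‖ = 1 := by linarith
    have hzero : ∑' n, sValue a (n + 1) = 0 := by linarith
    have hall : ∀ n, sValue a (n + 1) = 0 := fun n =>
      le_antisymm (hzero ▸ hs'.le_tsum n fun _ _ => sValue_nonneg a _) (sValue_nonneg a _)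
    have hrank : a = rankOneOp (η 0) (ξ 0) := by
      rw [ha_split, hnorm, he₁]
      simp [hall]
    rw [hrank] at ha hext
    exact hext (rankOneOp_mem_extremePoints_traceBall (hξ.1 0) (hη.1 0) ha)
  set D := 1 + T - 2 * ‖a‖ with hDdef
  constructor
  · let c : ℕ → ℝ := fun n => Nat.casesOn n ((T - 1) / D) fun m => 2 * sValue a (m + 1) / D
    have hc' : Summable fun n => c (n + 1) := (hs'.mul_left 2).div_const D
    have hc : Summable c := (summable_nat_add_iff 1).mp hc'
    have hyc : y = ∑' n, c n • rankOneOp (η n) (ξ n) := by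
      rw [(summable_smul_rankOneOp hξ hη hc).tsum_eq_zero_add, hy, he₁]
      rfl
    have habs (n : ℕ) : |c (n + 1)| = 2 * sValue a (n + 1) / D :=
      abs_of_nonneg (div_nonneg (mul_nonneg two_pos.le (sValue_nonneg a _)) hD.le)
    have hanti : Antitone fun n => |c (n + 1)| := fun m n hmn => by
      simp only [habs]
      gcongr
      exact sValue_antitone a (Nat.succ_le_succ hmn)
    have habs0 : |c 0| = (1 - T) / D := by
      change |(T - 1) / D| = _
      rw [abs_div, abs_of_pos hD, abs_of_nonpos (sub_nonpos.mpr hT1), neg_sub]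
    obtain ⟨σ, hσ, hrange, hσanti⟩ := exists_rearrangement_antitone_abs hc hanti
    rw [hyc, traceNorm_tsum_smul_rankOneOp hξ hη hc hσ hrange hσanti, hc.abs.tsum_eq_zero_add,
      habs0, tsum_congr habs, tsum_div_const, tsum_mul_left, ← add_div, div_eq_one_iff_eq hD.ne']
    linarith
  · have hfactor : ∑' n, (2 * sValue a (n + 1) / D) • rankOneOp (η (n + 1)) (ξ (n + 1))
        = (2 / D) • ∑' n, sValue a (n + 1) • rankOneOp (η (n + 1)) (ξ (n + 1)) := by
      rw [← ((summable_nat_add_iff 1).mpr hsum).tsum_const_smul]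
      refine tsum_congr fun n => ?_
      rw [smul_smul]
      congr 1
      ring
    have hlam : 1 - lam₀ = D / 2 := by rw [hlam₀]; ring
    have h1 : lam₀ + D / 2 * ((T - 1) / D) = ‖a‖ := by
      rw [hlam₀]
      field_simp
      ring
    have h2 : D / 2 * (2 / D) = 1 := by field_simp
    rw [hy, hfactor, hlam, smul_add, smul_smul, smul_smul, h2, one_smul, ← add_assoc, ← add_smul,
      h1]
    exact ha_split
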